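/- arXiv:math/0406412 — 5 statements merged into one kernel-verified Lean document; each statement's English description precedes it below -/
import Mathlib

section
/- Let k be an algebraically closed field (of arbitrary characteristic). Let A be an affine domain over k with trdeg_k(A) = 1 which is not isomorphic as a k-algebra to the polynomial ring k[X], and let B be an integral domain that is a k-algebra. Then AK(A ⊗_k B) equals the canonical image of AK(A) ⊗_k AK(B) in A ⊗_k B (equivalently, AK(A ⊗_k B) is the k-subalgebra of A ⊗_k B generated by the images of AK(A) and AK(B)). -/
open Polynomial TensorProduct

/-- An *exponential map* on a commutative `k`-algebra `A` is a `k`-algebra homomorphism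
`φ : A → A[t]` such that evaluation at `t = 0` composed with `φ` is the identity, and
applying `φ` coefficientwise to `φ a` equals substituting `s + t` for `t` in `φ a`. -/
def IsExponential {k A : Type*} [CommRing k] [CommRing A] [Algebra k A]
    (φ : A →ₐ[k] A[X]) : Prop :=
  (∀ a : A, (φ a).eval 0 = a) ∧
  (∀ a : A, (φ a).map (φ : A →+* A[X]) =
      (φ a).eval₂ ((C : A[X] →+* A[X][X]).comp (C : A →+* A[X])) (X + C X))

/-- The ring of `φ`-invariants `A^φ = {a : A | φ a = C a}`. -/
noncomputable def expInvariants {k A : Type*} [CommRing k] [CommRing A] [Algebra k A]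
    (φ : A →ₐ[k] A[X]) : Subalgebra k A :=
  AlgHom.equalizer φ ((Algebra.ofId A A[X]).restrictScalars k)

/-- The AK invariant (ring of absolute constants) of a commutative `k`-algebra `A`:
the intersection of `A^φ` over all exponential maps `φ` on `A`. -/
noncomputable def AK (k A : Type*) [CommRing k] [CommRing A] [Algebra k A] : Subalgebra k A :=
  ⨅ φ : {ψ : A →ₐ[k] A[X] // IsExponential ψ}, expInvariants φ.1

/-- `A` has transcendence degree 1 over `k`: some single element is a transcendence basis. -/
def TrdegOne (k A : Type*) [CommRing k] [CommRing A] [Algebra k A] : Prop :=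
  ∃ x : A, IsTranscendenceBasis k (fun _ : Unit => x)


theorem exists_algHom_apply_ne_zero {k A : Type*} [Field k] [IsAlgClosed k] [CommRing A]
    [IsDomain A] [Algebra k A] [Algebra.FiniteType k A] {c : A} (hc : c ≠ 0) :
    ∃ χ : A →ₐ[k] k, χ c ≠ 0 := by
  have : Nontrivial (Localization.Away c) :=
    (IsLocalization.injective (Localization.Away c)
      (powers_le_nonZeroDivisors_of_noZeroDivisors hc)).nontrivial
  obtain ⟨M, hM⟩ := Ideal.exists_maximal (Localization.Away c)
  let := Ideal.Quotient.field M
  have : Algebra.FiniteType A (Localization.Away c) :=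
    IsLocalization.finiteType_of_monoid_fg (Submonoid.powers c) _
  have : Algebra.FiniteType k (Localization.Away c) := Algebra.FiniteType.trans (S := A) ‹_› ‹_›
  have : Module.Finite k (Localization.Away c ⧸ M) :=
    finite_of_finite_type_of_isJacobsonRing _ _
  let e : k ≃ₐ[k] (Localization.Away c ⧸ M) :=
    AlgEquiv.ofBijective (Algebra.ofId _ _) IsAlgClosed.algebraMap_bijective_of_isIntegral
  refine ⟨(e.symm.toAlgHom.comp (Ideal.Quotient.mkₐ k M)).comp
    (IsScalarTower.toAlgHom k A (Localization.Away c)), ?_⟩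
  have hu : IsUnit (algebraMap A (Localization.Away c) c) :=
    IsLocalization.map_units _ (⟨c, Submonoid.mem_powers c⟩ : Submonoid.powers c)
  exact (hu.map (e.symm.toAlgHom.comp (Ideal.Quotient.mkₐ k M))).ne_zero

/-- The specialization `A ⊗ B → B` of the first tensor factor at a `k`-point of `A`. -/
noncomputable def specializeLeft {k A : Type*} (B : Type*) [CommRing k] [CommRing A] [Algebra k A]
    [CommRing B] [Algebra k B] (χ : A →ₐ[k] k) : A ⊗[k] B →ₐ[k] B :=
  Algebra.TensorProduct.lift ((Algebra.ofId k B).comp χ) (AlgHom.id k B)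
    (fun _ _ => Commute.all _ _)

@[simp]
theorem specializeLeft_tmul {k A B : Type*} [CommRing k] [CommRing A] [Algebra k A]
    [CommRing B] [Algebra k B] (χ : A →ₐ[k] k) (a : A) (b : B) :
    specializeLeft B χ (a ⊗ₜ b) = algebraMap k B (χ a) * b := by
  simp [specializeLeft, Algebra.ofId_apply]

theorem exists_ne_zero_forall_specializeLeft_ne_zero {k A B : Type*} [Field k] [CommRing A]
    [Algebra k A] [CommRing B] [Algebra k B] {z : A ⊗[k] B} (hz : z ≠ 0) :
    ∃ c : A, c ≠ 0 ∧ ∀ χ : A →ₐ[k] k, χ c ≠ 0 → specializeLeft B χ z ≠ 0 := by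
  classical
  let b := Module.Basis.ofVectorSpace k B
  have hrepr (χ : A →ₐ[k] k) (z : A ⊗[k] B) (i) : b.repr (specializeLeft B χ z) i =
      χ (TensorProduct.equivFinsuppOfBasisRight b z i) := by
    induction z with
    | zero => simp
    | add x y hx hy => simp [hx, hy]
    | tmul x y => rw [specializeLeft_tmul, ← Algebra.smul_def]; simp [mul_comm]
  have h : TensorProduct.equivFinsuppOfBasisRight b z ≠ 0 := by simpa using hz
  obtain ⟨i, hi⟩ := Finsupp.ne_iff.1 h
  refine ⟨_, hi, fun χ hχ h0 => hχ ?_⟩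
  rw [← hrepr, h0]
  simp

theorem isDomain_tensorProduct_of_isAlgClosed (k A B : Type*) [Field k] [IsAlgClosed k]
    [CommRing A] [IsDomain A] [Algebra k A] [Algebra.FiniteType k A]
    [CommRing B] [IsDomain B] [Algebra k B] : IsDomain (A ⊗[k] B) := by
  have : NoZeroDivisors (A ⊗[k] B) := by
    refine ⟨fun {u v} huv => ?_⟩
    by_contra! h
    obtain ⟨c, hc, hcu⟩ := exists_ne_zero_forall_specializeLeft_ne_zero h.1
    obtain ⟨d, hd, hdv⟩ := exists_ne_zero_forall_specializeLeft_ne_zero h.2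
    obtain ⟨χ, hχ⟩ := exists_algHom_apply_ne_zero (k := k) (mul_ne_zero hc hd)
    rw [map_mul] at hχ
    apply mul_ne_zero (hcu χ (left_ne_zero_of_mul hχ)) (hdv χ (right_ne_zero_of_mul hχ))
    rw [← map_mul, huv, map_zero]
  have : Nontrivial (A ⊗[k] B) := inferInstance
  exact NoZeroDivisors.to_isDomain _

theorem mem_AK_iff {k A : Type*} [CommRing k] [CommRing A] [Algebra k A] {a : A} :
    a ∈ AK k A ↔ ∀ φ : A →ₐ[k] A[X], IsExponential φ → φ a = C a := by
  simp only [AK, Algebra.mem_iInf, Subtype.forall]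
  rfl

/-- The extension of an exponential map on `B` to `A ⊗ B`, acting trivially on `A`. -/
noncomputable def extendRight {k : Type*} (A : Type*) {B : Type*} [CommRing k] [CommRing A]
    [Algebra k A] [CommRing B] [Algebra k B] (ψ : B →ₐ[k] B[X]) :
    A ⊗[k] B →ₐ[k] (A ⊗[k] B)[X] :=
  Algebra.TensorProduct.lift
    ((CAlgHom (R := k) (A := A ⊗[k] B)).comp Algebra.TensorProduct.includeLeft)
    ((mapAlgHom Algebra.TensorProduct.includeRight).comp ψ) (fun _ _ => Commute.all _ _)

theorem extendRight_tmul {k A B : Type*} [CommRing k] [CommRing A]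
    [Algebra k A] [CommRing B] [Algebra k B] (ψ : B →ₐ[k] B[X]) (a : A) (b : B) :
    extendRight A ψ (a ⊗ₜ b) = C (a ⊗ₜ 1) *
      (ψ b).map (Algebra.TensorProduct.includeRight : B →ₐ[k] A ⊗[k] B).toRingHom := by
  simp [extendRight]

theorem extendRight_one_tmul {k A B : Type*} [CommRing k] [CommRing A]
    [Algebra k A] [CommRing B] [Algebra k B] (ψ : B →ₐ[k] B[X]) (b : B) :
    extendRight A ψ (1 ⊗ₜ b) =
      (ψ b).map (Algebra.TensorProduct.includeRight : B →ₐ[k] A ⊗[k] B).toRingHom := by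
  rw [extendRight_tmul, ← Algebra.TensorProduct.one_def, C_1, one_mul]

theorem extendRight_tmul_one {k A B : Type*} [CommRing k] [CommRing A]
    [Algebra k A] [CommRing B] [Algebra k B] (ψ : B →ₐ[k] B[X]) (a : A) :
    extendRight A ψ (a ⊗ₜ 1) = C (a ⊗ₜ 1) := by
  simp [extendRight_tmul]

/-- Coassociativity is transported along a ring homomorphism intertwining two coactions. -/
theorem coassoc_of_intertwining {R S : Type*} [CommRing R] [CommRing S] (f : R →+* S)
    (φ : R →+* R[X]) (ψ : S →+* S[X]) (hf : ∀ r, ψ (f r) = (φ r).map f) {r : R}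
    (h : (φ r).map φ = (φ r).eval₂ ((C : R[X] →+* R[X][X]).comp (C : R →+* R[X])) (X + C X)) :
    (ψ (f r)).map ψ =
      (ψ (f r)).eval₂ ((C : S[X] →+* S[X][X]).comp (C : S →+* S[X])) (X + C X) := by
  have h' := congrArg (mapRingHom (mapRingHom f)) h
  rw [hom_eval₂, coe_mapRingHom, Polynomial.map_map] at h'
  have h1 : ψ.comp f = (mapRingHom f).comp φ := by
    ext r : 1
    simp [hf]
  have h2 : (C.comp C).comp f = (mapRingHom (mapRingHom f)).comp (C.comp C) := by
    ext r : 1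
    simp
  rw [hf, Polynomial.map_map, eval₂_map, h1, h', h2]
  simp

theorem isExponential_extendRight {k : Type*} (A : Type*) {B : Type*} [CommRing k] [CommRing A]
    [Algebra k A] [CommRing B] [Algebra k B] {ψ : B →ₐ[k] B[X]} (hψ : IsExponential ψ) :
    IsExponential (extendRight A ψ) := by
  constructor
  · intro z
    induction z with
    | zero => simp
    | add x y hx hy => simp [hx, hy]
    | tmul x y =>
      rw [extendRight_tmul, eval_mul, eval_C, eval_map]
      have := hom_eval₂ (ψ y) (RingHom.id B)
        (Algebra.TensorProduct.includeRight : B →ₐ[k] A ⊗[k] B).toRingHom 0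
      rw [map_zero, RingHom.comp_id] at this
      rw [← this, eval₂_id, hψ.1]
      simp
  · intro z
    induction z with
    | zero => simp
    | add x y hx hy => simp only [map_add, Polynomial.map_add, eval₂_add, hx, hy]
    | tmul x y =>
      rw [extendRight_tmul, Polynomial.map_mul, map_C, eval₂_mul, eval₂_C]
      congr 1
      · simp [extendRight_tmul_one]
      · rw [← extendRight_one_tmul]
        exact coassoc_of_intertwining Algebra.TensorProduct.includeRight.toRingHom ψ.toRingHom
          (extendRight A ψ).toRingHom (fun b => extendRight_one_tmul ψ b) (hψ.2 y)

theorem lid_rTensor_mem_AK {k A B : Type*} [CommRing k] [CommRing A]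
    [Algebra k A] [CommRing B] [Algebra k B] (l : A →ₗ[k] k) {z : A ⊗[k] B}
    (hz : z ∈ AK k (A ⊗[k] B)) : TensorProduct.lid k B (l.rTensor B z) ∈ AK k B := by
  rw [mem_AK_iff] at hz ⊢
  intro ψ hψ
  have key (z : A ⊗[k] B) (n : ℕ) :
      TensorProduct.lid k B (l.rTensor B ((extendRight A ψ z).coeff n)) =
        (ψ (TensorProduct.lid k B (l.rTensor B z))).coeff n := by
    induction z with
    | zero => simp
    | add x y hx hy => simp [hx, hy]
    | tmul x y => simp [extendRight_tmul]
  ext n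
  rw [← key, hz _ (isExponential_extendRight A hψ), coeff_C, coeff_C]
  split_ifs <;> simp

theorem AK_tensorProduct_le {k A B : Type*} [Field k] [CommRing A]
    [Algebra k A] [CommRing B] [Algebra k B] (hA : AK k A = ⊤) :
    AK k (A ⊗[k] B) ≤ (Algebra.TensorProduct.map (AK k A).val (AK k B).val).range := by
  classical
  intro z hz
  let e := Module.Basis.ofVectorSpace k A
  rw [← (TensorProduct.equivFinsuppOfBasisLeft e).symm_apply_apply z,
    TensorProduct.equivFinsuppOfBasisLeft_symm_apply]
  refine sum_mem fun i _ => ?_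
  rw [TensorProduct.equivFinsuppOfBasisLeft_apply]
  exact ⟨⟨e i, hA ▸ Algebra.mem_top⟩ ⊗ₜ ⟨_, lid_rTensor_mem_AK (e.coord i) hz⟩, by simp⟩

theorem isExponential_specializeLeft {k A B : Type*} [CommRing k] [CommRing A]
    [Algebra k A] [CommRing B] [Algebra k B] {φ : A ⊗[k] B →ₐ[k] (A ⊗[k] B)[X]}
    (hφ : IsExponential φ) (hA : ∀ a : A, φ (a ⊗ₜ 1) = C (a ⊗ₜ 1)) (χ : A →ₐ[k] k) :
    IsExponential (((mapAlgHom (specializeLeft B χ)).comp φ).comp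
      Algebra.TensorProduct.includeRight) := by
  set f := specializeLeft B χ with hf
  set ψ := ((mapAlgHom f).comp φ).comp Algebra.TensorProduct.includeRight with hψ
  have hψb (b : B) : ψ b = (φ (1 ⊗ₜ b)).map (f : A ⊗[k] B →+* B) := rfl
  have key (z : A ⊗[k] B) : ψ (f z) = (φ z).map (f : A ⊗[k] B →+* B) := by
    induction z with
    | zero => simp
    | add x y hx hy => simp [hx, hy]
    | tmul x y =>
      rw [show x ⊗ₜ[k] y = (x ⊗ₜ 1) * (1 ⊗ₜ y) by simp, map_mul, map_mul, map_mul, hA,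
        Polynomial.map_mul, ← hψb, map_C, hf, specializeLeft_tmul, specializeLeft_tmul]
      simp [Polynomial.algebraMap_apply]
  constructor
  · intro b
    rw [hψb, eval_map, ← map_zero (f : A ⊗[k] B →+* B), eval₂_at_apply, hφ.1]
    simp [hf]
  · intro b
    have h := coassoc_of_intertwining (f : A ⊗[k] B →+* B) φ.toRingHom ψ.toRingHom key
      (hφ.2 (1 ⊗ₜ b))
    simpa [hf] using h

theorem one_tmul_mem_AK {k A B : Type*} [Field k] [IsAlgClosed k]
    [CommRing A] [IsDomain A] [Algebra k A] [Algebra.FiniteType k A]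
    [CommRing B] [Algebra k B]
    (hA : ∀ a : A, a ⊗ₜ 1 ∈ AK k (A ⊗[k] B)) {b : B} (hb : b ∈ AK k B) :
    1 ⊗ₜ b ∈ AK k (A ⊗[k] B) := by
  simp only [mem_AK_iff] at hA hb ⊢
  intro φ hφ
  ext n
  rcases n with _ | n
  · rw [coeff_zero_eq_eval_zero, hφ.1, coeff_C_zero]
  · rw [coeff_C_succ]
    by_contra h
    obtain ⟨c, hc, hcz⟩ := exists_ne_zero_forall_specializeLeft_ne_zero h
    obtain ⟨χ, hχ⟩ := exists_algHom_apply_ne_zero (k := k) hc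
    apply hcz χ hχ
    have := congrArg (coeff · (n + 1)) (hb _ (isExponential_specializeLeft hφ (fun a => hA a φ hφ) χ))
    simpa using this

theorem surjective_of_dvd {k A : Type*} [Field k] [CommRing A] [IsDomain A] [Algebra k A]
    (β : A →ₐ[k] k[X]) {x : A}
    (hβ : Function.Injective β) (hx : (β x).natDegree ≠ 0)
    (hdvd : ∀ a : A, (β x).map (algebraMap k A) - C x ∣ (β a).map (algebraMap k A) - C a) :
    Function.Surjective (aeval x : k[X] →ₐ[k] A) := by
  suffices h : ∀ n, ∀ a : A, (β a).natDegree = n → a ∈ (aeval x : k[X] →ₐ[k] A).range from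
    fun a => h _ a rfl
  intro n
  induction n using Nat.strong_induction_on with
  | _ n ih =>
    intro a ha
    obtain ⟨q, hq⟩ := hdvd a
    have h0 : a = algebraMap k A ((β a).coeff 0) -
        (algebraMap k A ((β x).coeff 0) - x) * q.coeff 0 := by
      have := congrArg (coeff · 0) hq
      simp only [coeff_sub, coeff_map, coeff_C_zero, mul_coeff_zero] at this
      rw [← this]
      ring
    by_cases hn : n = 0
    · refine ⟨C ((β a).coeff 0), hβ ?_⟩
      change β (aeval x (C ((β a).coeff 0))) = β a
      rw [aeval_C, AlgHom.commutes, Polynomial.algebraMap_apply, Algebra.algebraMap_self,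
        RingHom.id_apply]
      exact (eq_C_of_natDegree_eq_zero (ha.trans hn)).symm
    · have hX : x ∈ (aeval x : k[X] →ₐ[k] A).range := ⟨X, aeval_X x⟩
      have hxc : (C ((β x).coeff 0) - β x).natDegree = (β x).natDegree := by
        rw [← neg_sub, natDegree_neg, natDegree_sub_C]
      have hβa : (β a - C ((β a).coeff 0)) = - ((C ((β x).coeff 0) - β x) * β (q.coeff 0)) := by
        conv_lhs => enter [1]; rw [h0]
        simp
      have hdeg := congrArg natDegree hβa
      rw [natDegree_sub_C, natDegree_neg] at hdeg
      have hq0 : β (q.coeff 0) ≠ 0 := by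
        intro h
        rw [h, mul_zero, natDegree_zero] at hdeg
        omega
      rw [natDegree_mul (fun h => hx (by rw [← hxc, h, natDegree_zero])) hq0, hxc] at hdeg
      have := ih _ (by omega) (q.coeff 0) rfl
      rw [h0]
      exact sub_mem (algebraMap_mem _ _) (mul_mem (sub_mem (algebraMap_mem _ _) hX) this)

theorem isIntegral_of_natDegree_ne_zero {k A : Type*} [Field k] [CommRing A] [Algebra k A]
    (β : A →ₐ[k] k[X]) {x : A} (hx : (β x).natDegree ≠ 0) : β.toRingHom.IsIntegral := by
  have : Nontrivial A := β.toRingHom.domain_nontrivial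
  let := β.toRingHom.toAlgebra
  have hX : IsIntegral A (X : k[X]) := by
    have hlc : (β x).leadingCoeff ≠ 0 := by
      rw [leadingCoeff_ne_zero]
      rintro h
      simp [h] at hx
    let p : k[X] := C (β x).leadingCoeff⁻¹ * β x
    have hp : p.Monic := by
      rw [Monic, leadingCoeff_mul, leadingCoeff_C, inv_mul_cancel₀ hlc]
    have hpd : p.natDegree = (β x).natDegree := natDegree_C_mul (inv_ne_zero hlc)
    refine ⟨p.map (algebraMap k A) - C (algebraMap k A (β x).leadingCoeff⁻¹ * x), ?_, ?_⟩
    · refine (hp.map _).sub_of_left ?_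
      rw [hp.degree_map]
      refine degree_C_le.trans_lt (natDegree_pos_iff_degree_pos.1 ?_)
      omega
    · rw [eval₂_sub, eval₂_C, eval₂_map]
      have : (algebraMap A k[X]).comp (algebraMap k A) = C := by
        ext c : 1
        exact β.commutes c
      rw [this, eval₂_C_X]
      change p - β _ = 0
      rw [map_mul, β.commutes]
      exact sub_self _
  intro f
  change IsIntegral A f
  induction f using Polynomial.induction_on' with
  | add p q hp hq => exact hp.add hq
  | monomial n c =>
    rw [← C_mul_X_pow_eq_monomial]
    refine IsIntegral.mul ?_ (hX.pow n)
    have : (C c : k[X]) = algebraMap A k[X] (algebraMap k A c) := (β.commutes c).symm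
    rw [this]
    exact isIntegral_algebraMap

theorem exists_coeff_natDegree_ne_zero_of_eval_eq_zero {k : Type*} [CommRing k] [Nontrivial k]
    {G : k[X][X]} (hG : G.Monic)
    (h0 : G.eval X = 0) : ∃ i, (G.coeff i).natDegree ≠ 0 := by
  by_contra! h
  have h1 (i) : G.coeff i = C ((G.coeff i).coeff 0) := eq_C_of_natDegree_eq_zero (h i)
  have h2 : G = (G.map constantCoeff).map C := by
    ext i : 1
    rw [coeff_map, coeff_map]
    exact h1 i
  rw [h2, eval_map, eval₂_C_X] at h0
  exact (hG.map (constantCoeff (R := k))).ne_zero h0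

open Polynomial.Bivariate in
theorem coeff_coeff_swap {R : Type*} [CommRing R] (p : R[X][X]) (i j : ℕ) :
    ((swap p).coeff i).coeff j = (p.coeff j).coeff i := by
  induction p using Polynomial.induction_on' with
  | add p q hp hq => simp [hp, hq]
  | monomial n f =>
    induction f using Polynomial.induction_on' with
    | add p q hp hq => simp [hp, hq]
    | monomial m r =>
      rw [swap_monomial_monomial]
      simp only [coeff_monomial]
      split_ifs <;> simp_all [coeff_monomial]

open Polynomial.Bivariate in
/-- A divisor of `x(T) - x(U)` with a `T`-coefficient of `U`-degree at least `deg x` is the whole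
of it, up to a constant. -/
theorem exists_eq_C_C_of_mul_eq {k : Type*} [Field k] {x : k[X]} (hx : x.natDegree ≠ 0)
    {G H : k[X][X]} (h : x.map C - C x = G * H) {i : ℕ}
    (hG : x.natDegree ≤ (G.coeff i).natDegree) : ∃ c : k, c ≠ 0 ∧ H = C (C c) := by
  have h1 : C x - x.map C = swap G * swap H := by
    rw [← map_mul, ← h, map_sub, swap_C, swap_map_C]
  have hdeg : (C x - x.map C : k[X][X]).natDegree = x.natDegree := by
    rw [← neg_sub, natDegree_neg, natDegree_sub_C, natDegree_map_eq_of_injective C_injective]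
  have hlc : (C x - x.map C : k[X][X]).leadingCoeff = C (-x.leadingCoeff) := by
    rw [leadingCoeff, hdeg, coeff_sub, coeff_C_of_ne_zero hx, coeff_map]
    simp
  have hx0 : x.leadingCoeff ≠ 0 := by
    rw [leadingCoeff_ne_zero]
    rintro rfl
    simp at hx
  have hne : swap G * swap H ≠ 0 := by
    rw [← h1, ← leadingCoeff_ne_zero, hlc]
    simpa using hx0
  have hGd : x.natDegree ≤ (swap G).natDegree := by
    refine hG.trans (le_natDegree_of_ne_zero fun h0 => ?_)
    have h2 := congrArg (coeff · i) h0
    simp only [coeff_coeff_swap, coeff_zero, coeff_natDegree, leadingCoeff_eq_zero] at h2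
    rw [h2, natDegree_zero] at hG
    omega
  have hd := natDegree_mul (left_ne_zero_of_mul hne) (right_ne_zero_of_mul hne)
  rw [← h1, hdeg] at hd
  have hH0 : (swap H).natDegree = 0 := by omega
  obtain ⟨g, hg⟩ : ∃ g, swap H = C g := ⟨_, eq_C_of_natDegree_eq_zero hH0⟩
  have hu : IsUnit g := by
    have h5 := hlc
    rw [h1, leadingCoeff_mul, hg, leadingCoeff_C] at h5
    refine isUnit_of_mul_isUnit_right (x := (swap G).leadingCoeff) ?_
    rw [h5]
    exact (isUnit_C).2 (by simpa using hx0)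
  obtain ⟨c, hc, rfl⟩ := isUnit_iff.1 hu
  refine ⟨c, hc.ne_zero, ?_⟩
  rw [← swap_swap_apply H, hg, swap_C, map_C]

/-- A normal `k`-subalgebra of `k[X]` other than `k` is a polynomial ring. -/
theorem nonempty_algEquiv_of_isIntegrallyClosed {k A : Type*} [Field k] [CommRing A] [IsDomain A]
    [Algebra k A] [IsIntegrallyClosed A] (β : A →ₐ[k] k[X]) (hβ : Function.Injective β) {y : A}
    (hy : (β y).natDegree ≠ 0) : Nonempty (A ≃ₐ[k] k[X]) := by
  let := β.toRingHom.toAlgebra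
  have hmap (a : A) : algebraMap A k[X] a = β a := rfl
  have hcomp : (algebraMap A k[X]).comp (algebraMap k A) = C := by
    ext c : 1
    exact β.commutes c
  have : Module.IsTorsionFree A k[X] := by
    rw [Module.isTorsionFree_iff_algebraMap_injective]
    exact hβ
  have hX : IsIntegral A (X : k[X]) := isIntegral_of_natDegree_ne_zero β hy X
  have hdvd (a : A) : minpoly A (X : k[X]) ∣ (β a).map (algebraMap k A) - C a := by
    apply minpoly.isIntegrallyClosed_dvd hX
    rw [aeval_def, eval₂_sub, eval₂_C, eval₂_map, hcomp, eval₂_C_X, hmap, sub_self]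
  have hmapsub (a : A) : ((β a).map (algebraMap k A) - C a).map (algebraMap A k[X]) =
      (β a).map C - C (β a) := by
    rw [Polynomial.map_sub, Polynomial.map_map, hcomp, map_C, hmap]
  obtain ⟨i, hi⟩ := exists_coeff_natDegree_ne_zero_of_eval_eq_zero
    ((minpoly.monic hX).map (algebraMap A k[X]))
    (by rw [eval_map_algebraMap, minpoly.aeval])
  set x := (minpoly A (X : k[X])).coeff i with hx
  rw [coeff_map, ← hx, hmap] at hi
  obtain ⟨H, hH⟩ := hdvd x
  have h1 := congrArg (Polynomial.map (algebraMap A k[X])) hH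
  rw [hmapsub, Polynomial.map_mul] at h1
  obtain ⟨c, hc, hHc⟩ := exists_eq_C_C_of_mul_eq hi h1 (i := i) (by rw [coeff_map, ← hx, hmap])
  have hHc' : H = C (algebraMap k A c) := by
    apply map_injective (algebraMap A k[X]) hβ
    rw [hHc, map_C, hmap, β.commutes]
    rfl
  have hHu : IsUnit H := by
    rw [hHc', isUnit_C]
    exact hc.isUnit.map _
  have hxdvd (a : A) : (β x).map (algebraMap k A) - C x ∣ (β a).map (algebraMap k A) - C a := by
    rw [hH, hHu.mul_right_dvd]
    exact hdvd a
  refine ⟨(AlgEquiv.ofBijective (aeval x : k[X] →ₐ[k] A)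
    ⟨?_, surjective_of_dvd β hβ hi hxdvd⟩).symm⟩
  have hcompβ : β.comp (aeval x) = aeval (β x) := by
    ext
    simp
  have : Function.Injective (β.comp (aeval x)) := by
    rw [hcompβ]
    refine transcendental_iff_injective.1 (Polynomial.transcendental _ hi ?_)
    refine mem_nonZeroDivisors_of_ne_zero (leadingCoeff_ne_zero.2 ?_)
    rintro h
    simp [h] at hi
  exact Function.Injective.of_comp this

theorem natDegree_eq_zero_of_isAlgebraic {R : Type*} [CommRing R] [IsDomain R] {f : R[X]}
    (h : IsAlgebraic R f) : f.natDegree = 0 := by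
  by_contra hf
  refine Polynomial.transcendental f hf (mem_nonZeroDivisors_of_ne_zero ?_) h
  rw [leadingCoeff_ne_zero]
  rintro rfl
  simp at hf

theorem IsExponential.eval₂_neg_X {k R : Type*} [CommRing k] [CommRing R] [Algebra k R]
    {φ : R →ₐ[k] R[X]} (hφ : IsExponential φ) (r : R) :
    (φ r).eval₂ (φ : R →+* R[X]) (-X) = C r := by
  have h := congrArg (eval (-X : R[X])) (hφ.2 r)
  rw [eval_map, ← coe_evalRingHom, hom_eval₂] at h
  rw [h]
  have h1 : (evalRingHom (-X : R[X])).comp ((C : R[X] →+* R[X][X]).comp (C : R →+* R[X])) = C := by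
    ext : 1
    simp
  have h2 : evalRingHom (-X : R[X]) (X + C X) = C 0 := by simp
  rw [h1, h2, eval₂_at_apply, hφ.1]

/-- If the quotient `p / q` is integral over `A`, then every injective `ι : A → R[X]` makes `ι q`
divide `ι p` up to a denominator in `R`. -/
theorem exists_dvd_C_mul_of_isIntegral {A R : Type*} [CommRing A] [IsDomain A] [CommRing R]
    [IsDomain R] (ι : A →+* R[X]) (hι : Function.Injective ι) {p q : A} (hq : q ≠ 0)
    (h : IsIntegral A (algebraMap A (FractionRing A) p / algebraMap A (FractionRing A) q)) :
    ∃ i : R, i ≠ 0 ∧ ι q ∣ C i * ι p := by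
  let K := FractionRing R
  let W := FractionRing K[X]
  have hm : Function.Injective (mapRingHom (algebraMap R K)) :=
    map_injective _ (IsFractionRing.injective R K)
  let g : A →+* W := ((algebraMap K[X] W).comp (mapRingHom (algebraMap R K))).comp ι
  have hg : Function.Injective g := ((IsFractionRing.injective K[X] W).comp hm).comp hι
  let l : FractionRing A →+* W := IsFractionRing.lift hg
  have hl (a : A) : l (algebraMap A _ a) = g a := IsFractionRing.lift_algebraMap hg a
  have hint := IsIntegral.map_of_comp_eq ((mapRingHom (algebraMap R K)).comp ι) l
    (by ext a : 1; exact (hl a).symm) h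
  obtain ⟨y, hy⟩ := IsIntegrallyClosed.isIntegral_iff.1 hint
  rw [map_div₀, hl, hl, eq_div_iff (by simpa using hg.ne hq)] at hy
  have hy' : y * (ι q).map (algebraMap R K) = (ι p).map (algebraMap R K) := by
    apply IsFractionRing.injective K[X] W
    rw [map_mul]
    exact hy
  obtain ⟨b, hb, hby⟩ := IsLocalization.integerNormalization_spec (nonZeroDivisors R) y
  refine ⟨b, nonZeroDivisors.ne_zero hb,
    IsLocalization.integerNormalization (nonZeroDivisors R) y, hm ?_⟩
  rw [map_mul, map_mul, coe_mapRingHom, hby, ← hy', map_C, Algebra.smul_def,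
    IsScalarTower.algebraMap_apply R K K[X], Polynomial.algebraMap_apply,
    Algebra.algebraMap_self, RingHom.id_apply]
  ring

/-- The ideal of denominators of a fraction is compatible with free extensions. -/
theorem mem_map_of_mul_mem_span {A R : Type*} [CommRing A] [CommRing R] [Algebra A R]
    [Module.Free A R] {p q : A} {m : Ideal A} (hm : ∀ a : A, q ∣ a * p → a ∈ m) {r : R}
    (hr : algebraMap A R q ∣ r * algebraMap A R p) : r ∈ m.map (algebraMap A R) := by
  let b := Module.Free.chooseBasis A R
  obtain ⟨s, hs⟩ := hr
  rw [← b.linearCombination_repr r, Finsupp.linearCombination_apply]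
  refine sum_mem fun i _ => ?_
  change b.repr r i • b i ∈ _
  rw [Algebra.smul_def]
  refine Ideal.mul_mem_right _ _ (Ideal.mem_map_of_mem _ (hm _ ⟨b.repr s i, ?_⟩))
  have h : p • r = q • s := by rw [Algebra.smul_def, Algebra.smul_def, mul_comm, hs]
  have := congrArg (fun z => b.repr z i) h
  simpa [mul_comm] using this

theorem exists_C_mem_map {k A R : Type*} [CommRing k] [CommRing A] [IsDomain A] [CommRing R]
    [IsDomain R] [Algebra k R] [Algebra A R] [Module.Free A R]
    {φ : R →ₐ[k] R[X]} (hφ : IsExponential φ) {p q : A} (hq : q ≠ 0)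
    (h : IsIntegral A (algebraMap A (FractionRing A) p / algebraMap A (FractionRing A) q))
    {m : Ideal A} (hm : ∀ a : A, q ∣ a * p → a ∈ m) :
    ∃ i : R, i ≠ 0 ∧ C i ∈ m.map ((φ : R →+* R[X]).comp (algebraMap A R)) := by
  have hφi : Function.Injective φ := fun a b hab => by rw [← hφ.1 a, hab, hφ.1 b]
  obtain ⟨i, hi, G, hG⟩ := exists_dvd_C_mul_of_isIntegral
    ((φ : R →+* R[X]).comp (algebraMap A R)) (hφi.comp (FaithfulSMul.algebraMap_injective A R)) hq h
  refine ⟨i, hi, ?_⟩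
  let τ : R[X] →+* R[X] := eval₂RingHom (φ : R →+* R[X]) (-X)
  have hτ (r : R) : τ (φ r) = C r := hφ.eval₂_neg_X r
  have hτC (r : R) : τ (C r) = φ r := eval₂_C _ _
  have h1 : φ i * C (algebraMap A R p) = C (algebraMap A R q) * τ G := by
    have := congrArg τ hG
    rw [map_mul, map_mul, hτC] at this
    simpa only [RingHom.comp_apply, RingHom.coe_coe, hτ] using this
  have h2 : φ i ∈ (m.map (algebraMap A R)).map C := by
    rw [Ideal.mem_map_C_iff]
    refine fun n => mem_map_of_mul_mem_span hm ⟨(τ G).coeff n, ?_⟩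
    have := congrArg (coeff · n) h1
    simpa only [coeff_mul_C, coeff_C_mul] using this
  have h3 := Ideal.mem_map_of_mem τ h2
  rw [hτ, Ideal.map_map, Ideal.map_map] at h3
  have h4 : (τ.comp C).comp (algebraMap A R) = (φ : R →+* R[X]).comp (algebraMap A R) := by
    ext a : 1
    exact hτC _
  rwa [h4] at h3

/-- Specialization of a family of curves `A → R[X]` at a suitable `k`-point of the base. -/
theorem exists_specialization {k A R : Type*} [Field k] [IsAlgClosed k] [CommRing A] [Algebra k A]
    [Algebra.FiniteType k A] [CommRing R] [IsDomain R] [Algebra k R] (α : A →ₐ[k] R[X])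
    {x : A} (hx : (α x).natDegree ≠ 0) {m : Ideal A} {i : R} (hi : i ≠ 0)
    (him : C i ∈ m.map α) :
    ∃ β : A →ₐ[k] k[X], (β x).natDegree ≠ 0 ∧ m.map β = ⊤ := by
  classical
  have : IsNoetherianRing A := Algebra.FiniteType.isNoetherianRing k A
  obtain ⟨s, rfl⟩ := (isNoetherianRing_iff_ideal_fg A).1 this m
  obtain ⟨g, hg⟩ := (Algebra.FiniteType.out : (⊤ : Subalgebra k A).FG)
  rw [Ideal.map_span, ← Finset.coe_image, Submodule.mem_span_finset'] at him
  obtain ⟨c, hc⟩ := him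
  let T : Finset R := (g.image α ∪ Finset.univ.image c).biUnion coeffs ∪ {i}
  let R' : Subalgebra k R := Algebra.adjoin k T
  have : Algebra.FiniteType k R' := (Subalgebra.fg_iff_finiteType _).1 ⟨T, rfl⟩
  let ρ : R'[X] →ₐ[k] R[X] := mapAlgHom R'.val
  have hρ : Function.Injective ρ := map_injective _ Subtype.val_injective
  have hρmem {f : R[X]} (hf : ∀ n, f.coeff n ≠ 0 → f.coeff n ∈ T) : f ∈ ρ.range := by
    have : f ∈ (mapRingHom (R'.val : R' →+* R)).range := by
      rw [mem_map_range]
      intro n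
      by_cases h0 : f.coeff n = 0
      · exact ⟨0, by rw [h0, map_zero]⟩
      · exact ⟨⟨_, Algebra.subset_adjoin (hf n h0)⟩, rfl⟩
    exact this
  have hαmem (a : A) : α a ∈ ρ.range := by
    suffices h : (⊤ : Subalgebra k A) ≤ ρ.range.comap α from h Algebra.mem_top
    rw [← hg, Algebra.adjoin_le_iff]
    intro a ha
    refine hρmem fun n hn => ?_
    exact Finset.mem_union_left _ (Finset.mem_biUnion.2 ⟨α a, Finset.mem_union_left _
      (Finset.mem_image_of_mem _ ha), coeff_mem_coeffs hn⟩)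
  have hcmem (j) : c j ∈ ρ.range := by
    refine hρmem fun n hn => ?_
    exact Finset.mem_union_left _ (Finset.mem_biUnion.2 ⟨c j, Finset.mem_union_right _
      (Finset.mem_image_of_mem _ (Finset.mem_univ _)), coeff_mem_coeffs hn⟩)
  let e := AlgEquiv.ofInjective ρ hρ
  let α' : A →ₐ[k] R'[X] := e.symm.toAlgHom.comp (α.codRestrict ρ.range hαmem)
  have hα' (a : A) : ρ (α' a) = α a :=
    congrArg Subtype.val (e.apply_symm_apply ⟨α a, hαmem a⟩)
  choose c' hc' using hcmem
  let i' : R' := ⟨i, Algebra.subset_adjoin (Finset.mem_union_right _ (Finset.mem_singleton_self i))⟩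
  have hi' : i' ≠ 0 := fun h => hi (congrArg Subtype.val h)
  have hmem : C i' ∈ (Ideal.span (s : Set A)).map α' := by
    have : C i' = ∑ j, c' j * α' (Finset.mem_image.1 j.2).choose := by
      apply hρ
      rw [map_sum]
      refine Eq.trans ?_ (hc.symm.trans (Finset.sum_congr rfl fun j _ => ?_))
      · exact map_C _
      · rw [map_mul, hα', (Finset.mem_image.1 j.2).choose_spec.2, smul_eq_mul]
        exact congrArg (· * _) (hc' j).symm
    rw [this]
    exact sum_mem fun j _ => Ideal.mul_mem_left _ _ (Ideal.mem_map_of_mem _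
      (Ideal.subset_span (Finset.mem_image.1 j.2).choose_spec.1))
  have hdeg : (α' x).natDegree = (α x).natDegree := by
    rw [← hα']
    exact (natDegree_map_eq_of_injective Subtype.val_injective _).symm
  have hlc : (α' x).leadingCoeff ≠ 0 := by
    rw [leadingCoeff_ne_zero]
    intro h
    rw [← hdeg, h, natDegree_zero] at hx
    exact hx rfl
  obtain ⟨χ, hχ⟩ := exists_algHom_apply_ne_zero (k := k) (mul_ne_zero hi' hlc)
  rw [map_mul] at hχ
  refine ⟨(mapAlgHom χ).comp α', ?_, ?_⟩
  · change ((α' x).map (χ : R' →+* k)).natDegree ≠ 0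
    rw [natDegree_map_of_leadingCoeff_ne_zero (χ : R' →+* k) (right_ne_zero_of_mul hχ), hdeg]
    exact hx
  · have h1 := Ideal.mem_map_of_mem (mapAlgHom χ) hmem
    have h2 : mapAlgHom χ (C i') = C (χ i') := map_C _
    rw [h2, Ideal.map_mapₐ] at h1
    exact Ideal.eq_top_of_isUnit_mem _ h1 (isUnit_C.2 (left_ne_zero_of_mul hχ).isUnit)

theorem injective_of_trdegOne {k A D : Type*} [Field k] [CommRing A] [IsDomain A] [Algebra k A]
    [CommRing D] [IsDomain D] [Algebra k D] {x : A}
    (hx : IsTranscendenceBasis k (fun _ : Unit => x)) (β : A →ₐ[k] D)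
    (hβ : Transcendental k (β x)) : Function.Injective β := by
  rw [injective_iff_map_eq_zero]
  intro a ha
  by_contra ha0
  have halg := hx.isAlgebraic
  obtain ⟨⟨r, hr⟩, hr0, hdvd⟩ := (halg.isAlgebraic a).exists_nonzero_dvd
    (mem_nonZeroDivisors_of_ne_zero ha0)
  rw [Set.range_const, Algebra.adjoin_singleton_eq_range_aeval] at hr
  obtain ⟨P, rfl⟩ := hr
  have h0 : β (aeval x P) = 0 := by
    have := map_dvd β hdvd
    rw [ha] at this
    exact zero_dvd_iff.1 this
  rw [← aeval_algHom_apply] at h0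
  have hP := (transcendental_iff.1 hβ) P h0
  subst hP
  exact hr0 (Subtype.ext (map_zero _))

theorem eq_C_of_trdegOne {k A R : Type*} [Field k] [CommRing A] [Algebra k A]
    [CommRing R] [IsDomain R] [Algebra k R] [Algebra A R] [IsScalarTower k A R]
    (hinj : Function.Injective (algebraMap A R)) {x : A}
    (hx : IsTranscendenceBasis k (fun _ : Unit => x)) {φ : R →ₐ[k] R[X]} (hφ : IsExponential φ)
    (hφx : (φ (algebraMap A R x)).natDegree = 0) (a : A) :
    φ (algebraMap A R a) = C (algebraMap A R a) := by
  have hC {r : R} (hr : (φ r).natDegree = 0) : φ r = C r := by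
    rw [eq_C_of_natDegree_eq_zero hr, coeff_zero_eq_eval_zero, hφ.1]
  have halg := hx.isAlgebraic
  refine hC (natDegree_eq_zero_of_isAlgebraic ?_)
  refine (halg.isAlgebraic a).ringHom_of_comp_eq
    ((algebraMap A R).comp (algebraMap (Algebra.adjoin k (Set.range fun _ : Unit => x)) A))
    ((φ : R →+* R[X]).comp (algebraMap A R)) (hinj.comp Subtype.val_injective) ?_
  ext ⟨r, hr⟩ : 1
  rw [Set.range_const, Algebra.adjoin_singleton_eq_range_aeval] at hr
  obtain ⟨P, rfl⟩ := hr
  change C (algebraMap A R (aeval x P)) = φ (algebraMap A R (aeval x P))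
  rw [← aeval_algebraMap_apply, ← aeval_algHom_apply φ, hC hφx]
  exact (aeval_algHom_apply (CAlgHom (R := k)) _ _).symm

/-- A curve that moves under some exponential map is the affine line. -/
theorem nonempty_algEquiv_of_isExponential {k A R : Type*} [Field k] [IsAlgClosed k] [CommRing A]
    [IsDomain A] [Algebra k A] [Algebra.FiniteType k A] [CommRing R] [IsDomain R] [Algebra k R]
    [Algebra A R] [IsScalarTower k A R] [Module.Free A R] {x : A}
    (hx : IsTranscendenceBasis k (fun _ : Unit => x)) {φ : R →ₐ[k] R[X]} (hφ : IsExponential φ)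
    (hφx : (φ (algebraMap A R x)).natDegree ≠ 0) : Nonempty (A ≃ₐ[k] k[X]) := by
  let α : A →ₐ[k] R[X] := φ.comp (IsScalarTower.toAlgHom k A R)
  have hβinj {β : A →ₐ[k] k[X]} (hβ : (β x).natDegree ≠ 0) : Function.Injective β := by
    refine injective_of_trdegOne hx β (Polynomial.transcendental _ hβ
      (mem_nonZeroDivisors_of_ne_zero (leadingCoeff_ne_zero.2 ?_)))
    intro h
    simp [h] at hβ
  have : IsIntegrallyClosed A := by
    rw [isIntegrallyClosed_iff (FractionRing A)]
    intro f hf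
    obtain ⟨p, q, hq, rfl⟩ := IsFractionRing.div_surjective (A := A) f
    by_contra hne
    let d : Ideal A := Submodule.comap (LinearMap.mulRight A p) (Ideal.span {q})
    have hd : d ≠ ⊤ := by
      intro h
      have h1 : (1 : A) ∈ d := h ▸ Submodule.mem_top
      have h2 : 1 * p ∈ Ideal.span {q} := h1
      rw [one_mul, Ideal.mem_span_singleton] at h2
      obtain ⟨y, rfl⟩ := h2
      refine hne ⟨y, ?_⟩
      rw [map_mul, mul_div_cancel_left₀]
      simpa using nonZeroDivisors.ne_zero hq
    obtain ⟨m, hm, hdm⟩ := Ideal.exists_le_maximal d hd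
    obtain ⟨i, hi, him⟩ := exists_C_mem_map hφ (nonZeroDivisors.ne_zero hq) hf (m := m)
      (fun a ha => hdm (Ideal.mem_span_singleton.2 ha))
    obtain ⟨β, hβ, hβm⟩ := exists_specialization α hφx hi him
    let := β.toRingHom.toAlgebra
    have : Algebra.IsIntegral A k[X] := ⟨isIntegral_of_natDegree_ne_zero β hβ⟩
    obtain ⟨Q, hQ, hQm⟩ := Ideal.exists_ideal_over_prime_of_isIntegral_of_isDomain (S := k[X]) m (by
      rw [(RingHom.injective_iff_ker_eq_bot (algebraMap A k[X])).1 (hβinj hβ)]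
      exact bot_le)
    refine hQ.ne_top (top_le_iff.1 ?_)
    rw [← hβm]
    exact Ideal.map_le_iff_le_comap.2 hQm.ge
  obtain ⟨β, hβ, -⟩ := exists_specialization α (m := ⊤) hφx one_ne_zero (by
    rw [Ideal.map_top]
    exact Submodule.mem_top)
  exact nonempty_algEquiv_of_isIntegrallyClosed β (hβinj hβ) hβ

theorem algebraMap_mem_AK {k A R : Type*} [Field k] [IsAlgClosed k] [CommRing A]
    [IsDomain A] [Algebra k A] [Algebra.FiniteType k A] [CommRing R] [IsDomain R] [Algebra k R]
    [Algebra A R] [IsScalarTower k A R] [Module.Free A R] (htr : TrdegOne k A)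
    (hA : IsEmpty (A ≃ₐ[k] k[X])) (a : A) : algebraMap A R a ∈ AK k R := by
  obtain ⟨x, hx⟩ := htr
  rw [mem_AK_iff]
  intro φ hφ
  refine eq_C_of_trdegOne (FaithfulSMul.algebraMap_injective A R) hx hφ ?_ a
  by_contra h
  exact not_nonempty_iff.2 hA (nonempty_algEquiv_of_isExponential hx hφ h)

/-- **Theorem (main).** Let `k` be an algebraically closed field, `A` an affine domain over `k`
of transcendence degree 1 which is not isomorphic to `k[X]`, and `B` a domain over `k`.
Then `AK(A ⊗ₖ B)` equals the canonical image of `AK(A) ⊗ₖ AK(B)` in `A ⊗ₖ B`. -/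
theorem ak_tensor_eq_tensor_ak
    {k A B : Type*} [Field k] [IsAlgClosed k]
    [CommRing A] [IsDomain A] [Algebra k A] [Algebra.FiniteType k A]
    (htr : TrdegOne k A) (hA : IsEmpty (A ≃ₐ[k] Polynomial k))
    [CommRing B] [IsDomain B] [Algebra k B] :
    AK k (A ⊗[k] B) =
      (Algebra.TensorProduct.map (AK k A).val (AK k B).val).range := by
  have := isDomain_tensorProduct_of_isAlgClosed k A B
  have hleft (a : A) : a ⊗ₜ 1 ∈ AK k (A ⊗[k] B) := algebraMap_mem_AK htr hA a
  refine le_antisymm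
    (AK_tensorProduct_le (top_le_iff.1 fun a _ => algebraMap_mem_AK (R := A) htr hA a)) ?_
  rintro _ ⟨z, rfl⟩
  induction z with
  | zero => exact zero_mem _
  | add x y hx hy =>
    rw [map_add]
    exact add_mem hx hy
  | tmul a b =>
    change (a : A) ⊗ₜ[k] (b : B) ∈ _
    rw [show (a : A) ⊗ₜ[k] (b : B) = ((a : A) ⊗ₜ[k] (1 : B)) * ((1 : A) ⊗ₜ[k] (b : B)) by simp]
    exact mul_mem (hleft a) (one_tmul_mem_AK hleft b.2)
end

section
/- Let k be a field, let A be an integral domain that is a k-algebra, and let φ be an exponential map on A. Then A^φ is algebraically closed in A: if a ∈ A is a root of some nonzero polynomial with coefficients in A^φ, then a ∈ A^φ. -/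
open Polynomial TensorProduct

/-- **Lemma 1(b).** The ring of `φ`-invariants is algebraically closed in `A`. -/
theorem expInvariants_algebraically_closed
    {k A : Type*} [Field k] [CommRing A] [IsDomain A] [Algebra k A]
    (φ : A →ₐ[k] A[X]) (hφ : IsExponential φ) {a : A} (p : A[X])
    (hp : p ≠ 0) (hcoeff : ∀ i : ℕ, p.coeff i ∈ expInvariants φ)
    (hroot : p.eval a = 0) :
    a ∈ expInvariants φ := by
  have hcoe : ∀ b : A, b ∈ expInvariants φ ↔ φ b = C b := fun _ => Iff.rfl
  have hcomp : p.comp (φ a) = 0 := by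
    rw [← map_zero φ, ← hroot, comp, eval₂_eq_sum, eval_eq_sum, sum_def, sum_def, map_sum]
    refine Finset.sum_congr rfl fun i _ => ?_
    rw [map_mul, map_pow, (hcoe _).1 (hcoeff i)]
  obtain h | ⟨-, h⟩ := comp_eq_zero_iff.1 hcomp
  · exact absurd h hp
  · rwa [coeff_zero_eq_eval_zero, hφ.1] at h
end

section
/- Let k be a field, let A be an integral domain that is a k-algebra, let φ be an exponential map on A, and let D = {D^i} be the associated higher derivation. Then for every a ∈ A and every natural number i, deg_φ(D^i(a)) ≤ deg_φ(a) − i. In particular, if a ∈ A is nonzero and n = deg_φ(a), then D^n(a) is a nonzero element of A^φ. -/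
open Polynomial TensorProduct

/-- An exponential map sends the `i`-th coefficient of `φ a` to the `i`-th Hasse derivative
of `φ a`. -/
theorem IsExponential.apply_coeff {k A : Type*} [CommRing k] [CommRing A] [Algebra k A]
    {φ : A →ₐ[k] A[X]} (hφ : IsExponential φ) (a : A) (i : ℕ) :
    φ ((φ a).coeff i) = hasseDeriv i (φ a) := by
  have h := congrArg (fun p => p.coeff i) (hφ.2 a)
  have hcomp : (φ a).eval₂ ((C : A[X] →+* A[X][X]).comp (C : A →+* A[X])) (X + C X) =
      taylor X ((φ a).map C) := by
    rw [taylor_apply, comp, eval₂_map]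
  have hmap : hasseDeriv i ((φ a).map C) = (hasseDeriv i (φ a)).map C := by
    ext1 n
    simp [hasseDeriv_coeff]
  simpa only [hcomp, taylor_coeff, hmap, coeff_map, eval_map, eval₂_C_X, RingHom.coe_coe] using h

/-- **Lemma 1(c).** `deg_φ(Dⁱ a) ≤ deg_φ(a) - i`; in particular for `a ≠ 0` and
`n = deg_φ(a)`, the leading coefficient `Dⁿ(a)` is a nonzero `φ`-invariant. -/
theorem degPhi_coeff_le
    {k A : Type*} [Field k] [CommRing A] [IsDomain A] [Algebra k A]
    (φ : A →ₐ[k] A[X]) (hφ : IsExponential φ) :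
    (∀ (a : A) (i : ℕ),
      (φ ((φ a).coeff i)).degree + (i : WithBot ℕ) ≤ (φ a).degree) ∧
    (∀ a : A, a ≠ 0 →
      (φ a).coeff (φ a).natDegree ∈ expInvariants φ ∧
      (φ a).coeff (φ a).natDegree ≠ 0) := by
  have hdeg (a : A) (i : ℕ) :
      (φ ((φ a).coeff i)).degree + (i : WithBot ℕ) ≤ (φ a).degree := by
    rw [hφ.apply_coeff]
    by_cases h0 : hasseDeriv i (φ a) = 0
    · simp [h0]
    · rw [degree_eq_natDegree h0, ← Nat.cast_add]
      refine le_degree_of_ne_zero fun h => h0 (leadingCoeff_eq_zero.mp ?_)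
      rw [leadingCoeff, hasseDeriv_coeff, h, mul_zero]
  refine ⟨hdeg, fun a ha => ⟨?_, ?_⟩⟩
  · change φ _ = C _
    rw [hφ.apply_coeff, hasseDeriv_natDegree_eq_C, leadingCoeff]
  · refine leadingCoeff_ne_zero.mpr fun h => ha ?_
    rw [← hφ.1 a, h, eval_zero]
end

section
/- Let k be a field, let A be an integral domain that is a k-algebra, let φ be a nontrivial exponential map on A (i.e. φ is not the constant-polynomial inclusion A → A[t]), let D = {D^i} be the associated higher derivation, and let x ∈ A be an element of minimal positive φ-degree. Then D^i(x) ∈ A^φ for every i ≥ 1; moreover, if the characteristic of A is a prime p, then D^i(x) = 0 whenever i ≥ 1 is not a power of p, and if the characteristic is 0 then D^i(x) = 0 for all i ≥ 2. -/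
open Polynomial TensorProduct

/-- A positive integer that is not a power of the prime `p` has an intermediate binomial
coefficient prime to `p`. -/
theorem exists_not_dvd_choose_of_ne_prime_pow {p : ℕ} (hp : p.Prime) (n : ℕ) (hn : 1 ≤ n)
    (h : ∀ m : ℕ, n ≠ p ^ m) : ∃ j, 0 < j ∧ j < n ∧ ¬ p ∣ n.choose j := by
  induction n using Nat.strong_induction_on with
  | _ n ih =>
    by_cases hpn : p ∣ n
    · obtain ⟨a, rfl⟩ := hpn
      have ha : 1 ≤ a := Nat.pos_of_mul_pos_left hn
      obtain ⟨j, hj0, hja, hj⟩ := ih a (by nlinarith [hp.two_le]) ha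
        fun m hm => h (m + 1) (by rw [hm, pow_succ'])
      refine ⟨p * j, Nat.mul_pos hp.pos hj0, Nat.mul_lt_mul_of_pos_left hja hp.pos, ?_⟩
      have := Fact.mk hp
      have key := Choose.choose_modEq_choose_mod_mul_choose_div_nat (n := p * a) (k := p * j) (p := p)
      simp only [Nat.mul_mod_right, Nat.mul_div_cancel_left _ hp.pos, Nat.choose_self,
        one_mul] at key
      rwa [key.dvd_iff dvd_rfl]
    · have h1 : n ≠ 1 := by simpa using h 0
      exact ⟨1, one_pos, by omega, by simpa using hpn⟩

section HigherDerivation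

variable {k A : Type*} [CommRing k] [CommRing A] [Algebra k A] {φ : A →ₐ[k] A[X]}

/-- The iterative law `Dⁱ ∘ Dʲ = (i + j choose i) Dⁱ⁺ʲ` of the associated higher derivation. -/
theorem IsExponential.coeff_coeff (hφ : IsExponential φ) (a : A) (i j : ℕ) :
    (φ ((φ a).coeff j)).coeff i = ((i + j).choose j : A) * (φ a).coeff (i + j) := by
  have h := congrArg (fun q => (q.coeff j).coeff i) (hφ.2 a)
  simp only [coeff_map, RingHom.coe_coe] at h
  rw [h, eval₂_eq_sum_range, finsetSum_coeff, finsetSum_coeff]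
  have hterm : ∀ n, (((((C : A[X] →+* A[X][X]).comp (C : A →+* A[X])) ((φ a).coeff n) *
      (X + C X) ^ n).coeff j).coeff i) =
      if n = i + j then ((i + j).choose j : A) * (φ a).coeff (i + j) else 0 := by
    intro n
    rw [RingHom.comp_apply, coeff_C_mul, coeff_C_mul, coeff_X_add_C_pow, ← C_eq_natCast,
      coeff_mul_C, coeff_X_pow]
    by_cases hn : n = i + j
    · subst hn
      simp [mul_comm]
    · rw [if_neg hn]
      rcases lt_or_ge n j with hlt | hge
      · simp [Nat.choose_eq_zero_of_lt hlt]
      · rw [if_neg (by omega)]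
        simp
  simp only [hterm, Finset.sum_ite_eq', Finset.mem_range]
  split_ifs with hlt
  · rfl
  · rw [coeff_eq_zero_of_natDegree_lt (by omega), mul_zero]

theorem IsExponential.mem_expInvariants_iff (hφ : IsExponential φ) (a : A) :
    a ∈ expInvariants φ ↔ (φ a).degree ≤ 0 := by
  change φ a = C a ↔ _
  refine ⟨fun h => h ▸ degree_C_le, fun h => ?_⟩
  rw [eq_C_of_degree_le_zero h, coeff_zero_eq_eval_zero, hφ.1 a]

/-- Over an element of minimal positive degree, every positive-order `Dʲ` is invariant. -/
theorem IsExponential.coeff_mem_expInvariants (hφ : IsExponential φ) {x : A}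
    (hmin : ∀ a : A, 0 < (φ a).degree → (φ x).degree ≤ (φ a).degree) {j : ℕ} (hj : 1 ≤ j) :
    (φ x).coeff j ∈ expInvariants φ := by
  rw [hφ.mem_expInvariants_iff]
  by_contra! hpos
  have hle := natDegree_le_natDegree (hmin _ hpos)
  have hd := natDegree_pos_iff_degree_pos.2 hpos
  have hne : φ ((φ x).coeff j) ≠ 0 := fun h0 => by simp [h0] at hd
  apply leadingCoeff_ne_zero.2 hne
  rw [leadingCoeff, hφ.coeff_coeff]
  exact mul_eq_zero_of_right _ (coeff_eq_zero_of_natDegree_lt (by omega))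

/-- If `Dʲ(x)` is invariant, then `(n choose j) Dⁿ(x) = 0` for `j < n`. -/
theorem IsExponential.choose_mul_coeff_eq_zero (hφ : IsExponential φ) {x : A} {j n : ℕ}
    (hj : (φ x).coeff j ∈ expInvariants φ) (hjn : j < n) :
    (n.choose j : A) * (φ x).coeff n = 0 := by
  have h := hφ.coeff_coeff x (n - j) j
  rw [Nat.sub_add_cancel hjn.le] at h
  rw [← h]
  exact coeff_eq_zero_of_degree_lt
    (((hφ.mem_expInvariants_iff _).1 hj).trans_lt (by exact_mod_cast Nat.sub_pos_of_lt hjn))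

end HigherDerivation

/-- **Lemma 2(a).** For `x` of minimal positive `φ`-degree, all `Dⁱ(x)` (`i ≥ 1`) are
`φ`-invariants; in characteristic `p` prime, `Dⁱ(x) = 0` unless `i` is a power of `p`;
in characteristic `0`, `Dⁱ(x) = 0` for all `i ≥ 2`. -/
theorem coeff_of_min_degree_element
    {k A : Type*} [Field k] [CommRing A] [IsDomain A] [Algebra k A]
    (φ : A →ₐ[k] A[X]) (hφ : IsExponential φ) (hnt : ∃ a : A, φ a ≠ C a)
    (x : A) (hx : 0 < (φ x).degree)
    (hmin : ∀ a : A, 0 < (φ a).degree → (φ x).degree ≤ (φ a).degree) :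
    (∀ i : ℕ, 1 ≤ i → (φ x).coeff i ∈ expInvariants φ) ∧
    (∀ p : ℕ, p.Prime → CharP A p →
      ∀ i : ℕ, 1 ≤ i → (∀ m : ℕ, i ≠ p ^ m) → (φ x).coeff i = 0) ∧
    (CharZero A → ∀ i : ℕ, 2 ≤ i → (φ x).coeff i = 0) := by
  have hinv : ∀ i : ℕ, 1 ≤ i → (φ x).coeff i ∈ expInvariants φ :=
    fun _ => hφ.coeff_mem_expInvariants hmin
  refine ⟨hinv, fun p hp _ i hi hpow => ?_, fun _ i hi => ?_⟩
  · obtain ⟨j, hj0, hji, hj⟩ := exists_not_dvd_choose_of_ne_prime_pow hp i hi hpow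
    refine (mul_eq_zero.1 (hφ.choose_mul_coeff_eq_zero (hinv j hj0) hji)).resolve_left ?_
    rwa [CharP.cast_eq_zero_iff A p]
  · refine (mul_eq_zero.1 (hφ.choose_mul_coeff_eq_zero (hinv 1 le_rfl) hi)).resolve_left ?_
    rw [Nat.choose_one_right, Nat.cast_eq_zero]
    omega
end

section
/- Let k be a field, let A be an integral domain that is a k-algebra, let φ be a nontrivial exponential map on A (i.e. not the constant-polynomial inclusion), and let x ∈ A be an element of minimal positive φ-degree n. Then for every nonzero a ∈ A, n divides deg_φ(a). -/
open Polynomial TensorProduct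

/-- Pseudo-division: after multiplying by a power of the leading coefficient of `g`, one can
divide with remainder by `g`. -/
theorem Polynomial.exists_leadingCoeff_pow_mul_eq_mul_add {R : Type*} [CommRing R]
    (g : R[X]) (hg : 0 < g.natDegree) (f : R[X]) :
    ∃ (m : ℕ) (q r : R[X]),
      C (g.leadingCoeff ^ m) * f = q * g + r ∧ r.natDegree < g.natDegree := by
  induction hN : f.natDegree using Nat.strong_induction_on generalizing f with
  | _ N ih =>
    rcases lt_or_ge f.natDegree g.natDegree with hlt | hle
    · exact ⟨0, 0, f, by simp, hlt⟩
    · obtain ⟨m, q, r, h, hr⟩ := ih _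
        (hN ▸ natDegree_cancelLeads_lt_of_natDegree_le_natDegree hle (hg.trans_le hle))
        (g.cancelLeads f) rfl
      refine ⟨m + 1, q + C (g.leadingCoeff ^ m * f.leadingCoeff) *
        X ^ (f.natDegree - g.natDegree), r, ?_, hr⟩
      rw [cancelLeads, Nat.sub_eq_zero_of_le hle] at h
      simp only [C_mul, C_pow] at h ⊢
      linear_combination h

/-- Uniqueness of division with remainder by a polynomial over a domain, for remainders of
smaller degree. -/
theorem Polynomial.remainder_unique {R : Type*} [CommRing R] [IsDomain R]
    {g q q' r r' : R[X]} (h : q * g + r = q' * g + r')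
    (hr : r.natDegree < g.natDegree) (hr' : r'.natDegree < g.natDegree) :
    q = q' ∧ r = r' := by
  have hg : g ≠ 0 := by rintro rfl; simp at hr
  have hq : q = q' := by
    by_contra hne
    have hd : (q - q') * g = r' - r := by linear_combination h
    have h1 := congrArg natDegree hd
    rw [natDegree_mul (sub_ne_zero.2 hne) hg] at h1
    have h2 := natDegree_sub_le r' r
    omega
  subst hq
  exact ⟨rfl, add_left_cancel h⟩

namespace IsExponential

variable {k A : Type*} [CommRing k] [CommRing A] [Algebra k A] {φ : A →ₐ[k] A[X]}

theorem injective (hφ : IsExponential φ) : Function.Injective (φ : A →+* A[X]) :=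
  fun a b h => by rw [← hφ.1 a, ← hφ.1 b, show φ a = φ b from h]

theorem map_eq_taylor (hφ : IsExponential φ) (a : A) :
    (φ a).map (φ : A →+* A[X]) = taylor X ((φ a).map C) := by
  rw [hφ.2, taylor_apply, comp, eval₂_map]

/-- The leading coefficient of `φ a` is `φ`-invariant. -/
theorem map_leadingCoeff (hφ : IsExponential φ) (a : A) :
    φ (φ a).leadingCoeff = C (φ a).leadingCoeff := by
  have h := congrArg leadingCoeff (hφ.map_eq_taylor a)
  rwa [leadingCoeff_taylor, leadingCoeff_map_of_injective hφ.injective,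
    leadingCoeff_map_of_injective C_injective] at h

/-- A polynomial whose coefficientwise image under `φ` is its translate is in the image
of `φ`. -/
theorem map_eval_zero_of_map_eq_taylor {p : A[X]}
    (h : p.map (φ : A →+* A[X]) = taylor X (p.map C)) : φ (p.eval 0) = p := by
  have h0 := congrArg (eval 0) h
  rw [taylor_eval, zero_add, eval_map, eval₂_at_zero, eval_map, eval₂_C_X] at h0
  rw [← coeff_zero_eq_eval_zero]
  exact h0

/-- If `φ a` is divided with remainder by `φ x`, the quotient is in the image of `φ`. -/
theorem map_eval_zero_quotient [IsDomain A] (hφ : IsExponential φ) {a x : A} {q r : A[X]}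
    (h : φ a = q * φ x + r) (hr : r.natDegree < (φ x).natDegree) :
    φ (q.eval 0) = q := by
  refine map_eval_zero_of_map_eq_taylor (remainder_unique (g := (φ x).map (φ : A →+* A[X]))
    (r := r.map (φ : A →+* A[X])) (r' := taylor X (r.map C)) ?_ ?_ ?_).1
  · have ha := hφ.map_eq_taylor a
    rw [h, Polynomial.map_add, Polynomial.map_mul, Polynomial.map_add, Polynomial.map_mul,
      map_add, taylor_mul, ← hφ.map_eq_taylor x] at ha
    exact ha
  · rwa [natDegree_map_eq_of_injective hφ.injective, natDegree_map_eq_of_injective hφ.injective]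
  · rwa [natDegree_taylor, natDegree_map_eq_of_injective C_injective,
      natDegree_map_eq_of_injective hφ.injective]

end IsExponential

/-- **Lemma 2(b).** If `x` has minimal positive `φ`-degree `n`, then `n` divides the
`φ`-degree of every nonzero element of `A`. -/
theorem min_degree_dvd_degPhi
    {k A : Type*} [Field k] [CommRing A] [IsDomain A] [Algebra k A]
    (φ : A →ₐ[k] A[X]) (hφ : IsExponential φ) (hnt : ∃ a : A, φ a ≠ C a)
    (x : A) (hx : 0 < (φ x).degree)
    (hmin : ∀ a : A, 0 < (φ a).degree → (φ x).degree ≤ (φ a).degree) :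
    ∀ a : A, a ≠ 0 → (φ x).natDegree ∣ (φ a).natDegree := by
  intro a ha
  rw [← natDegree_pos_iff_degree_pos] at hx
  have hc : (φ x).leadingCoeff ≠ 0 := leadingCoeff_ne_zero.2 (ne_zero_of_natDegree_gt hx)
  induction hN : (φ a).natDegree using Nat.strong_induction_on generalizing a with
  | _ N ih =>
    rcases Nat.eq_zero_or_pos (φ a).natDegree with h0 | hpos
    · simp [← hN, h0]
    · have hle := natDegree_le_natDegree (hmin a (natDegree_pos_iff_degree_pos.1 hpos))
      obtain ⟨m, q, r, h, hr⟩ := exists_leadingCoeff_pow_mul_eq_mul_add (φ x) hx (φ a)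
      have hdeg := congrArg natDegree h
      rw [natDegree_C_mul (pow_ne_zero m hc)] at hdeg
      have hq : q ≠ 0 := by
        rintro rfl
        rw [zero_mul, zero_add] at hdeg
        omega
      have hqx := natDegree_mul hq (ne_zero_of_natDegree_gt hx)
      rw [natDegree_add_eq_left_of_natDegree_lt (by omega), hqx] at hdeg
      rw [C_pow, ← hφ.map_leadingCoeff, ← map_pow, ← map_mul] at h
      have hφq := hφ.map_eval_zero_quotient h hr
      have hdvd := ih q.natDegree (by omega) (q.eval 0)
        (fun h0 => hq (by rw [← hφq, h0, map_zero])) (by rw [hφq])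
      rw [← hN, hdeg]
      exact dvd_add hdvd dvd_rfl
end
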